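/- arXiv:1605.03653 — 6 statements merged into one kernel-verified Lean document; each statement's English description precedes it below -/
import Mathlib

section
/- Fix κ ∈ (1/2,1), q ∈ [0,1], w > 0, and a finite Borel measure μ on [0,1] having a continuous, everywhere positive density with respect to Lebesgue measure. Then the implied probability map φ : [1−κ, κ] → ℝ, defined piecewise by φ(p) = M₁(p)/(min{w, ζ₂(p)} + M₁(p) + M₂(p)) for p ∈ [1−κ, p̄₂), φ(p) = M₁(p)/(M₁(p)+M₂(p)) for p ∈ [p̄₂, p̄₁], and φ(p) = (min{w, ζ₁(p)} + M₁(p))/(min{w, ζ₁(p)} + M₁(p) + M₂(p)) for p ∈ (p̄₁, κ], is continuous and antitone on [1−κ, κ], satisfies φ(1−κ) = 1 and φ(κ) = 0, and has exactly one fixed point, which lies in the open interval (1−κ, κ). -/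
open MeasureTheory Set

noncomputable section

/-- `μ` is a finite Borel measure on `[0,1]` with a continuous, everywhere positive
density with respect to Lebesgue measure. -/
def NiceDensity (μ : Measure ℝ) : Prop :=
  ∃ g : ℝ → ℝ, ContinuousOn g (Icc 0 1) ∧ (∀ p ∈ Icc (0:ℝ) 1, 0 < g p) ∧
    μ = (volume.restrict (Icc (0:ℝ) 1)).withDensity (fun p => ENNReal.ofReal (g p))

/-- `M₁(p) = μ((p/κ, 1])`, the total amount diffuse players wager on Outcome 1 when
the implied probability of Outcome 1 is `p`. -/
def M1 (μ : Measure ℝ) (κ p : ℝ) : ℝ := (μ (Ioc (p / κ) 1)).toReal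

/-- `M₂(p) = μ([0, 1 - (1-p)/κ))`, the total amount diffuse players wager on
Outcome 2 when the implied probability of Outcome 1 is `p`. -/
def M2 (μ : Measure ℝ) (κ p : ℝ) : ℝ := (μ (Ico 0 (1 - (1 - p) / κ))).toReal

/-- The atomic player's unconstrained optimal wager on Outcome 1. -/
def zeta1 (μ : Measure ℝ) (κ q p : ℝ) : ℝ :=
  Real.sqrt (κ * q / (1 - κ * q) * M1 μ κ p * M2 μ κ p) - M1 μ κ p

/-- The atomic player's unconstrained optimal wager on Outcome 2. -/
def zeta2 (μ : Measure ℝ) (κ q p : ℝ) : ℝ :=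
  Real.sqrt (κ * (1 - q) / (1 - κ * (1 - q)) * M1 μ κ p * M2 μ κ p) - M2 μ κ p

/-- The implied probability map `φ`. -/
def phi (μ : Measure ℝ) (κ q w p1bar p2bar p : ℝ) : ℝ :=
  if p < p2bar then
    M1 μ κ p / (min w (zeta2 μ κ q p) + M1 μ κ p + M2 μ κ p)
  else if p ≤ p1bar then
    M1 μ κ p / (M1 μ κ p + M2 μ κ p)
  else
    (min w (zeta1 μ κ q p) + M1 μ κ p) /
      (min w (zeta1 μ κ q p) + M1 μ κ p + M2 μ κ p)


lemma nice_cdf (μ : Measure ℝ) (hμ : NiceDensity μ) :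
    ∃ F : ℝ → ℝ, Continuous F ∧ StrictMono F ∧ F 0 = 0 ∧
      (∀ a b, 0 ≤ a → a ≤ b → b ≤ 1 → (μ (Ioc a b)).toReal = F b - F a) ∧
      (∀ a b, 0 ≤ a → a ≤ b → b ≤ 1 → (μ (Ico a b)).toReal = F b - F a) := by
  obtain ⟨g, hg, hpos, rfl⟩ := hμ
  set G : ℝ → ℝ := IccExtend (zero_le_one : (0:ℝ) ≤ 1) ((Icc (0:ℝ) 1).domRestrict g) with hG
  have hGc : Continuous G := (continuousOn_iff_continuous_domRestrict.1 hg).Icc_extend'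
  have hGpos : ∀ x, 0 < G x := fun x => by
    simp only [hG, IccExtend, Function.comp, domRestrict_apply]
    exact hpos _ (Subtype.property _)
  have hGg : ∀ x ∈ Icc (0:ℝ) 1, G x = g x := fun x hx => by
    rw [hG, IccExtend_of_mem _ _ hx, domRestrict_apply]
  have hint : ∀ a b, IntervalIntegrable G volume a b := fun a b => hGc.intervalIntegrable a b
  have key : ∀ a b, 0 ≤ a → a ≤ b → b ≤ 1 →
      (((volume.restrict (Icc (0:ℝ) 1)).withDensity (fun p => ENNReal.ofReal (g p)))
        (Ioc a b)).toReal = (∫ x in (0:ℝ)..b, G x) - ∫ x in (0:ℝ)..a, G x := by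
    intro a b ha hab hb
    rw [intervalIntegral.integral_interval_sub_left (hint _ _) (hint _ _),
      intervalIntegral.integral_of_le hab, withDensity_apply _ measurableSet_Ioc,
      Measure.restrict_restrict measurableSet_Ioc]
    have hsub : Ioc a b ⊆ Icc (0:ℝ) 1 := fun x hx => ⟨ha.trans hx.1.le, hx.2.trans hb⟩
    rw [inter_eq_left.2 hsub, integral_eq_lintegral_of_nonneg_ae
      (Filter.Eventually.of_forall fun x => (hGpos x).le) hGc.aestronglyMeasurable]
    congr 1
    refine setLIntegral_congr_fun measurableSet_Ioc fun x hx => ?_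
    simp only [hGg x (hsub hx)]
  refine ⟨fun t => ∫ x in (0:ℝ)..t, G x, ?_, ?_, by simp, key, ?_⟩
  · exact intervalIntegral.continuous_primitive (fun a b => hint a b) 0
  · intro a b hab
    have h1 := intervalIntegral.integral_interval_sub_left (hint 0 b) (hint 0 a)
    have h2 : 0 < ∫ x in a..b, G x :=
      intervalIntegral.intervalIntegral_pos_of_pos (hint a b) hGpos hab
    simp only
    linarith
  · intro a b ha hab hb
    rw [← key a b ha hab hb]
    congr 1
    refine measure_congr ?_
    have hac : ((volume.restrict (Icc (0:ℝ) 1)).withDensity (fun p => ENNReal.ofReal (g p)))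
        ≪ volume := (withDensity_absolutelyContinuous _ _).trans
          (Measure.absolutelyContinuous_of_le Measure.restrict_le_self)
    exact hac.ae_eq Ico_ae_eq_Ioc

lemma M_facts (μ : Measure ℝ) (hμ : NiceDensity μ) (κ : ℝ) (hκ : κ ∈ Ioo (1/2 : ℝ) 1) :
    ContinuousOn (M1 μ κ) (Icc (1 - κ) κ) ∧ ContinuousOn (M2 μ κ) (Icc (1 - κ) κ) ∧
    StrictAntiOn (M1 μ κ) (Icc (1 - κ) κ) ∧ StrictMonoOn (M2 μ κ) (Icc (1 - κ) κ) ∧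
    M1 μ κ κ = 0 ∧ M2 μ κ (1 - κ) = 0 := by
  obtain ⟨F, hFc, hFm, hF0, h1, h2⟩ := nice_cdf μ hμ
  obtain ⟨hk1, hk2⟩ := hκ
  have hk : 0 < κ := by linarith
  have e1 : EqOn (M1 μ κ) (fun p => F 1 - F (p / κ)) (Icc (1 - κ) κ) := fun p hp =>
    h1 _ _ (div_nonneg (by linarith [hp.1]) hk.le) ((div_le_one hk).2 hp.2) le_rfl
  have e2 : EqOn (M2 μ κ) (fun p => F (1 - (1 - p) / κ)) (Icc (1 - κ) κ) := fun p hp => by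
    have a1 : (1 - p) / κ ≤ 1 := (div_le_one hk).2 (by linarith [hp.1])
    have a2 : 0 ≤ (1 - p) / κ := div_nonneg (by linarith [hp.2]) hk.le
    have := h2 0 (1 - (1 - p) / κ) le_rfl (by linarith) (by linarith)
    simpa [hF0, M2] using this
  refine ⟨?_, ?_, ?_, ?_, ?_, ?_⟩
  · exact ContinuousOn.congr (by fun_prop) e1
  · exact ContinuousOn.congr (by fun_prop) e2
  · intro a ha b hb hab
    rw [e1 ha, e1 hb]
    have := hFm (div_lt_div_of_pos_right hab hk)
    simp only
    linarith
  · intro a ha b hb hab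
    rw [e2 ha, e2 hb]
    apply hFm
    have := div_lt_div_of_pos_right (show 1 - b < 1 - a by linarith) hk
    linarith
  · rw [e1 ⟨by linarith, le_rfl⟩]
    simp [hk.ne']
  · rw [e2 ⟨le_rfl, by linarith⟩]
    simp [hk.ne', hF0]

lemma min_key {c w x x' y y' : ℝ} (hc : 0 ≤ c) (hw : 0 < w) (hx' : 0 ≤ x') (hxx : x' ≤ x)
    (hy : 0 ≤ y) (hyy : y ≤ y') :
    x' * min (w + y) (Real.sqrt (c * x * y)) ≤ x * min (w + y') (Real.sqrt (c * x' * y')) := by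
  have hx : 0 ≤ x := hx'.trans hxx
  rcases le_total (w + y') (Real.sqrt (c * x' * y')) with h | h
  · rw [min_eq_left h]
    exact mul_le_mul hxx ((min_le_left _ _).trans (by linarith))
      (le_min (by linarith) (Real.sqrt_nonneg _)) hx
  · rw [min_eq_right h]
    refine (mul_le_mul_of_nonneg_left (min_le_right _ _) hx').trans ?_
    have e1 : x' * Real.sqrt (c * x * y) = Real.sqrt (x' ^ 2 * (c * x * y)) := by
      rw [Real.sqrt_mul (sq_nonneg _), Real.sqrt_sq hx']
    have e2 : x * Real.sqrt (c * x' * y') = Real.sqrt (x ^ 2 * (c * x' * y')) := by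
      rw [Real.sqrt_mul (sq_nonneg _), Real.sqrt_sq hx]
    rw [e1, e2]
    apply Real.sqrt_le_sqrt
    have : x' * y ≤ x * y' := mul_le_mul hxx hyy hy hx
    have h3 : 0 ≤ c * x * x' := by positivity
    nlinarith [mul_le_mul_of_nonneg_left this h3]

lemma ratio_le {A B A' B' : ℝ} (h : 0 < A + B) (h' : 0 < A' + B') (k : A' * B ≤ A * B') :
    A' / (A' + B') ≤ A / (A + B) := by
  rw [div_le_div_iff₀ h' h]
  nlinarith

/-- If `y ≤ c x` with `c = a/(1-a)` then `y ≤ √(c x y)`. -/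
lemma le_sqrt_of {a x y : ℝ} (ha1 : a < 1) (hy : 0 ≤ y)
    (h : y ≤ a * (x + y)) : y ≤ Real.sqrt (a / (1 - a) * x * y) := by
  apply Real.le_sqrt_of_sq_le
  have : y ≤ a / (1 - a) * x := by
    rw [div_mul_eq_mul_div, le_div_iff₀ (by linarith)]
    linarith
  nlinarith

lemma sqrt_le_of {a x y : ℝ} (ha1 : a < 1) (hy : 0 ≤ y)
    (h : a * (x + y) ≤ y) : Real.sqrt (a / (1 - a) * x * y) ≤ y := by
  apply Real.sqrt_le_iff.2 ⟨hy, ?_⟩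
  have : a / (1 - a) * x ≤ y := by
    rw [div_mul_eq_mul_div, div_le_iff₀ (by linarith)]
    linarith
  nlinarith

/-- Steps 5-6 of the main theorem: `φ` is continuous, antitone, takes values `1`
and `0` at the endpoints of `[1-κ, κ]`, and has a unique fixed point, which lies
in `(1-κ, κ)`. -/
theorem stmt_12 (κ q w : ℝ) (hκ : κ ∈ Ioo (1/2 : ℝ) 1) (hq : q ∈ Icc (0:ℝ) 1)
    (hw : 0 < w) (μ : Measure ℝ) (hμ : NiceDensity μ)
    (p1bar p2bar : ℝ)
    (hp1 : p1bar ∈ Ioc (1 - κ) κ)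
    (hp1q : q = M1 μ κ p1bar / (κ * (M1 μ κ p1bar + M2 μ κ p1bar)))
    (hp2 : p2bar ∈ Ico (1 - κ) κ)
    (hp2q : 1 - q = M2 μ κ p2bar / (κ * (M1 μ κ p2bar + M2 μ κ p2bar))) :
    ContinuousOn (phi μ κ q w p1bar p2bar) (Icc (1 - κ) κ) ∧
    AntitoneOn (phi μ κ q w p1bar p2bar) (Icc (1 - κ) κ) ∧
    phi μ κ q w p1bar p2bar (1 - κ) = 1 ∧
    phi μ κ q w p1bar p2bar κ = 0 ∧
    ∃ p ∈ Ioo (1 - κ) κ, phi μ κ q w p1bar p2bar p = p ∧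
      ∀ p' ∈ Icc (1 - κ) κ, phi μ κ q w p1bar p2bar p' = p' → p' = p := by
  obtain ⟨c1, c2, s1, s2, z1, z2⟩ := M_facts μ hμ κ hκ
  obtain ⟨hk1, hk2⟩ := hκ
  obtain ⟨hq0, hq1⟩ := hq
  have hk : 0 < κ := by linarith
  have mL : (1 - κ) ∈ Icc (1 - κ) κ := ⟨le_rfl, by linarith⟩
  have mR : κ ∈ Icc (1 - κ) κ := ⟨by linarith, le_rfl⟩
  have m1 : p1bar ∈ Icc (1 - κ) κ := ⟨hp1.1.le, hp1.2⟩
  have m2 : p2bar ∈ Icc (1 - κ) κ := ⟨hp2.1, hp2.2.le⟩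
  have n1 : ∀ p ∈ Icc (1 - κ) κ, 0 ≤ M1 μ κ p := fun p _ => ENNReal.toReal_nonneg
  have n2 : ∀ p ∈ Icc (1 - κ) κ, 0 ≤ M2 μ κ p := fun p _ => ENNReal.toReal_nonneg
  have a1 := s1.antitoneOn
  have a2 := s2.monotoneOn
  have hS : ∀ p ∈ Icc (1 - κ) κ, 0 < M1 μ κ p + M2 μ κ p := by
    intro p hp
    rcases hp.2.lt_or_eq with h | h
    · have := s1 hp mR h
      linarith [n2 p hp]
    · have := s2 mL hp (by linarith)
      linarith [n1 p hp]
  have t0 : 0 ≤ κ * q := by positivity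
  have t1 : κ * q < 1 := by nlinarith
  have u0 : 0 ≤ κ * (1 - q) := mul_nonneg hk.le (by linarith)
  have u1 : κ * (1 - q) < 1 := by nlinarith
  have E1 : κ * q * (M1 μ κ p1bar + M2 μ κ p1bar) = M1 μ κ p1bar := by
    have := hS _ m1
    rw [eq_div_iff (by positivity)] at hp1q
    linarith
  have E2 : κ * (1 - q) * (M1 μ κ p2bar + M2 μ κ p2bar) = M2 μ κ p2bar := by
    have := hS _ m2
    rw [eq_div_iff (by positivity)] at hp2q
    linarith
  generalize hs : κ * q = s at *
  generalize hu : κ * (1 - q) = u at *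
  have hsu : s + u = κ := by rw [← hs, ← hu]; ring
  have X : ∀ a ∈ Icc (1 - κ) κ, ∀ b ∈ Icc (1 - κ) κ, a ≤ b →
      M2 μ κ a * M1 μ κ b ≤ M2 μ κ b * M1 μ κ a := fun a ha b hb hab =>
    mul_le_mul (a2 ha hb hab) (a1 ha hb hab) (n1 b hb) (n2 b hb)
  -- signs
  have L2 : ∀ p ∈ Icc (1 - κ) κ, p ≤ p2bar → M2 μ κ p ≤ u * (M1 μ κ p + M2 μ κ p) := by
    intro p hp h
    have := X p hp _ m2 h
    refine le_of_mul_le_mul_right ?_ (hS _ m2)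
    have e : u * (M1 μ κ p + M2 μ κ p) * (M1 μ κ p2bar + M2 μ κ p2bar)
      = M2 μ κ p2bar * (M1 μ κ p + M2 μ κ p) := by
        linear_combination (M1 μ κ p + M2 μ κ p) * E2
    rw [e]; linarith
  have G2 : ∀ p ∈ Icc (1 - κ) κ, p2bar ≤ p → u * (M1 μ κ p + M2 μ κ p) ≤ M2 μ κ p := by
    intro p hp h
    have := X _ m2 p hp h
    refine le_of_mul_le_mul_right ?_ (hS _ m2)
    have e : u * (M1 μ κ p + M2 μ κ p) * (M1 μ κ p2bar + M2 μ κ p2bar)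
      = M2 μ κ p2bar * (M1 μ κ p + M2 μ κ p) := by
        linear_combination (M1 μ κ p + M2 μ κ p) * E2
    rw [e]; linarith
  have L1 : ∀ p ∈ Icc (1 - κ) κ, p1bar ≤ p → M1 μ κ p ≤ s * (M2 μ κ p + M1 μ κ p) := by
    intro p hp h
    have := X _ m1 p hp h
    refine le_of_mul_le_mul_right ?_ (hS _ m1)
    have e : s * (M2 μ κ p + M1 μ κ p) * (M1 μ κ p1bar + M2 μ κ p1bar)
      = M1 μ κ p1bar * (M1 μ κ p + M2 μ κ p) := by
        linear_combination (M1 μ κ p + M2 μ κ p) * E1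
    rw [e]; linarith
  have G1 : ∀ p ∈ Icc (1 - κ) κ, p ≤ p1bar → s * (M2 μ κ p + M1 μ κ p) ≤ M1 μ κ p := by
    intro p hp h
    have := X p hp _ m1 h
    refine le_of_mul_le_mul_right ?_ (hS _ m1)
    have e : s * (M2 μ κ p + M1 μ κ p) * (M1 μ κ p1bar + M2 μ κ p1bar)
      = M1 μ κ p1bar * (M1 μ κ p + M2 μ κ p) := by
        linear_combination (M1 μ κ p + M2 μ κ p) * E1
    rw [e]; linarith
  have h21 : p2bar ≤ p1bar := by
    by_contra! h
    have b1 := L1 _ m2 h.le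
    have b2 := hS _ m2
    have b3 : κ * (M1 μ κ p2bar + M2 μ κ p2bar) < M1 μ κ p2bar + M2 μ κ p2bar := by nlinarith
    have b4 : κ * (M1 μ κ p2bar + M2 μ κ p2bar) = s * (M2 μ κ p2bar + M1 μ κ p2bar)
        + u * (M1 μ κ p2bar + M2 μ κ p2bar) := by
      linear_combination (-(M1 μ κ p2bar + M2 μ κ p2bar)) * hsu
    linarith
  set R1 : ℝ → ℝ := fun p => Real.sqrt (s / (1 - s) * M1 μ κ p * M2 μ κ p) with hR1
  set R2 : ℝ → ℝ := fun p => Real.sqrt (u / (1 - u) * M1 μ κ p * M2 μ κ p) with hR2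
  have d1 : ∀ p ∈ Icc (1 - κ) κ, p1bar ≤ p → M1 μ κ p ≤ R1 p := fun p hp h => by
    have := le_sqrt_of t1 (n1 p hp) (L1 p hp h)
    rwa [mul_right_comm] at this
  have d1' : ∀ p ∈ Icc (1 - κ) κ, p ≤ p1bar → R1 p ≤ M1 μ κ p := fun p hp h => by
    have := sqrt_le_of t1 (n1 p hp) (G1 p hp h)
    rwa [mul_right_comm] at this
  have d2 : ∀ p ∈ Icc (1 - κ) κ, p ≤ p2bar → M2 μ κ p ≤ R2 p := fun p hp h =>
    le_sqrt_of u1 (n2 p hp) (L2 p hp h)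
  have d2' : ∀ p ∈ Icc (1 - κ) κ, p2bar ≤ p → R2 p ≤ M2 μ κ p := fun p hp h =>
    sqrt_le_of u1 (n2 p hp) (G2 p hp h)
  set A : ℝ → ℝ := fun p => max (M1 μ κ p) (min (w + M1 μ κ p) (R1 p)) with hA
  set B : ℝ → ℝ := fun p => max (M2 μ κ p) (min (w + M2 μ κ p) (R2 p)) with hB
  have A1 : ∀ p ∈ Icc (1 - κ) κ, p ≤ p1bar → A p = M1 μ κ p := fun p hp h =>
    max_eq_left ((min_le_right _ _).trans (d1' p hp h))
  have A2 : ∀ p ∈ Icc (1 - κ) κ, p1bar ≤ p → A p = min (w + M1 μ κ p) (R1 p) := fun p hp h =>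
    max_eq_right (le_min (by linarith) (d1 p hp h))
  have B1 : ∀ p ∈ Icc (1 - κ) κ, p2bar ≤ p → B p = M2 μ κ p := fun p hp h =>
    max_eq_left ((min_le_right _ _).trans (d2' p hp h))
  have B2 : ∀ p ∈ Icc (1 - κ) κ, p ≤ p2bar → B p = min (w + M2 μ κ p) (R2 p) := fun p hp h =>
    max_eq_right (le_min (by linarith) (d2 p hp h))
  have AB : ∀ p ∈ Icc (1 - κ) κ, 0 < A p + B p := fun p hp =>
    lt_of_lt_of_le (hS p hp) (add_le_add (le_max_left _ _) (le_max_left _ _))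
  have hphi : EqOn (phi μ κ q w p1bar p2bar) (fun p => A p / (A p + B p)) (Icc (1 - κ) κ) := by
    intro p hp
    simp only [phi]
    split_ifs with h h'
    · rw [A1 p hp (h.le.trans h21), B2 p hp h.le]
      have : min w (zeta2 μ κ q p) + M2 μ κ p = min (w + M2 μ κ p) (R2 p) := by
        rw [min_add, zeta2, hu, sub_add_cancel]
      rw [← this]
      congr 1
      ring
    · rw [A1 p hp h', B1 p hp (not_lt.1 h)]
    · rw [A2 p hp (not_le.1 h').le, B1 p hp (not_lt.1 h)]
      have : min w (zeta1 μ κ q p) + M1 μ κ p = min (w + M1 μ κ p) (R1 p) := by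
        rw [min_add, zeta1, hs, sub_add_cancel]
      rw [← this]
  have cR1 : ContinuousOn R1 (Icc (1 - κ) κ) :=
    ((continuousOn_const.mul c1).mul c2).sqrt
  have cR2 : ContinuousOn R2 (Icc (1 - κ) κ) :=
    ((continuousOn_const.mul c1).mul c2).sqrt
  have cA : ContinuousOn A (Icc (1 - κ) κ) := c1.sup ((continuousOn_const.add c1).inf cR1)
  have cB : ContinuousOn B (Icc (1 - κ) κ) := c2.sup ((continuousOn_const.add c2).inf cR2)
  have hcont : ContinuousOn (phi μ κ q w p1bar p2bar) (Icc (1 - κ) κ) :=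
    ContinuousOn.congr (cA.div (cA.add cB) fun p hp => (AB p hp).ne') hphi
  have P1 : ∀ a ∈ Icc (1 - κ) κ, ∀ b ∈ Icc (1 - κ) κ, a ≤ b → b ≤ p2bar →
      A b / (A b + B b) ≤ A a / (A a + B a) := by
    intro a ha b hb hab h
    refine ratio_le (AB a ha) (AB b hb) ?_
    rw [A1 a ha (by linarith), A1 b hb (by linarith), B2 a ha (by linarith), B2 b hb h]
    exact min_key (div_nonneg u0 (by linarith)) hw (n1 b hb) (a1 ha hb hab) (n2 a ha)
      (a2 ha hb hab)
  have P2 : ∀ a ∈ Icc (1 - κ) κ, ∀ b ∈ Icc (1 - κ) κ, a ≤ b → p2bar ≤ a → b ≤ p1bar →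
      A b / (A b + B b) ≤ A a / (A a + B a) := by
    intro a ha b hb hab h h'
    refine ratio_le (AB a ha) (AB b hb) ?_
    rw [A1 a ha (by linarith), A1 b hb (by linarith), B1 a ha h, B1 b hb (by linarith)]
    linarith [X a ha b hb hab]
  have P3 : ∀ a ∈ Icc (1 - κ) κ, ∀ b ∈ Icc (1 - κ) κ, a ≤ b → p1bar ≤ a →
      A b / (A b + B b) ≤ A a / (A a + B a) := by
    intro a ha b hb hab h
    refine ratio_le (AB a ha) (AB b hb) ?_
    rw [A2 a ha h, A2 b hb (by linarith), B1 a ha (by linarith), B1 b hb (by linarith)]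
    have := min_key (c := s / (1 - s)) (div_nonneg t0 (by linarith)) hw (n2 a ha)
      (a2 ha hb hab) (n1 b hb) (a1 ha hb hab)
    rw [mul_right_comm _ (M2 μ κ b), mul_right_comm _ (M2 μ κ a)] at this
    linarith
  have P23 : ∀ a ∈ Icc (1 - κ) κ, ∀ b ∈ Icc (1 - κ) κ, a ≤ b → p2bar ≤ a →
      A b / (A b + B b) ≤ A a / (A a + B a) := by
    intro a ha b hb hab h
    rcases le_total b p1bar with hb1 | hb1
    · exact P2 a ha b hb hab h hb1
    rcases le_total p1bar a with h1 | h1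
    · exact P3 a ha b hb hab h1
    · exact (P3 _ m1 b hb hb1 le_rfl).trans (P2 a ha _ m1 h1 h le_rfl)
  have hanti : AntitoneOn (phi μ κ q w p1bar p2bar) (Icc (1 - κ) κ) := by
    intro a ha b hb hab
    rw [hphi ha, hphi hb]
    rcases le_total b p2bar with hb1 | hb1
    · exact P1 a ha b hb hab hb1
    rcases le_total p2bar a with h1 | h1
    · exact P23 a ha b hb hab h1
    · exact (P23 _ m2 b hb hb1 le_rfl).trans (P1 a ha _ m2 h1 le_rfl)
  have v1 : phi μ κ q w p1bar p2bar (1 - κ) = 1 := by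
    have hpos := AB _ mL
    rw [hphi mL]
    have : B (1 - κ) = 0 := by simp [hB, hR2, z2, hw.le]
    simp only [this, add_zero] at hpos ⊢
    exact div_self hpos.ne'
  have v0 : phi μ κ q w p1bar p2bar κ = 0 := by
    rw [hphi mR]
    have : A κ = 0 := by simp [hA, hR1, z1, hw.le]
    simp only [this, zero_div]
  refine ⟨hcont, hanti, v1, v0, ?_⟩
  have hsub : ContinuousOn (fun p => phi μ κ q w p1bar p2bar p - p) (Icc (1 - κ) κ) :=
    hcont.sub continuousOn_id
  obtain ⟨p, hp, hfp⟩ := intermediate_value_Icc' (by linarith) hsub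
    (show (0:ℝ) ∈ _ by constructor <;> simp only [v0, v1] <;> linarith)
  have hfp' : phi μ κ q w p1bar p2bar p = p := by
    simp only at hfp
    linarith
  refine ⟨p, ⟨lt_of_le_of_ne hp.1 ?_, lt_of_le_of_ne hp.2 ?_⟩, hfp', ?_⟩
  · rintro rfl
    linarith
  · rintro rfl
    linarith
  · intro p' hp' h'
    rcases le_total p p' with h | h
    · have := hanti hp hp' h
      linarith
    · have := hanti hp' hp h
      linarith
end
end

section
/- Let κ ∈ (0,1), q ∈ [0,1], and let d₁, d₂ > 0 be real numbers with q > d₁/(κ(d₁+d₂)). Define Φ : ℝ²₊ → ℝ by Φ(b₁,b₂) = b₁·(κ(b₁+d₁+b₂+d₂)q/(b₁+d₁) − 1) + b₂·(κ(b₁+d₁+b₂+d₂)(1−q)/(b₂+d₂) − 1), and set b₁* = √(κqd₁d₂/(1−κq)) − d₁. Then the function b₁ ↦ Φ(b₁, 0) is strictly increasing on the interval [0, b₁*]. -/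
open Set

noncomputable section

/-- The expected profit of a risk-neutral atomic bettor who believes Outcome 1
occurs with probability `q` and wagers `b1` on Outcome 1 and `b2` on Outcome 2,
when the other bettors collectively wager `d1` on Outcome 1 and `d2` on Outcome 2
and the house retains the fraction `1 - κ` of the pool. -/
def Phi (κ q d1 d2 b1 b2 : ℝ) : ℝ :=
  b1 * (κ * (b1 + d1 + b2 + d2) * q / (b1 + d1) - 1) +
  b2 * (κ * (b1 + d1 + b2 + d2) * (1 - q) / (b2 + d2) - 1)

/-- Along the axis `b₂ = 0`, the atomic bettor's expected profit is strictly
increasing in `b₁` up to Isaacs' optimal wager `b₁*`. -/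
theorem stmt_15 (κ q d1 d2 : ℝ) (hκ : κ ∈ Ioo (0:ℝ) 1) (hq : q ∈ Icc (0:ℝ) 1)
    (hd1 : 0 < d1) (hd2 : 0 < d2) (h : q > d1 / (κ * (d1 + d2))) :
    StrictMonoOn (fun b1 => Phi κ q d1 d2 b1 0)
      (Icc 0 (Real.sqrt (κ * q * d1 * d2 / (1 - κ * q)) - d1)) := by
  obtain ⟨hκ0, hκ1⟩ := hκ
  obtain ⟨hq0, hq1⟩ := hq
  have ha : 0 < 1 - κ * q := by nlinarith
  intro x hx y hy hxy
  have hx0 : 0 < x + d1 := by linarith [hx.1]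
  have hy0 : 0 < y + d1 := by linarith [hy.1]
  have hyle : y + d1 ≤ Real.sqrt (κ * q * d1 * d2 / (1 - κ * q)) := by linarith [hy.2]
  have hnn : 0 ≤ κ * q * d1 * d2 / (1 - κ * q) := by positivity
  have hsq : (y + d1) ^ 2 ≤ κ * q * d1 * d2 / (1 - κ * q) :=
    (Real.le_sqrt hy0.le hnn).1 hyle
  rw [le_div_iff₀ ha] at hsq
  have hlt : (x + d1) * (y + d1) < (y + d1) ^ 2 := by nlinarith
  have hpos : 0 < κ * q * d1 * d2 - (1 - κ * q) * ((x + d1) * (y + d1)) := by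
    nlinarith [mul_lt_mul_of_pos_right hlt ha]
  have key : Phi κ q d1 d2 y 0 - Phi κ q d1 d2 x 0 =
      (y - x) * (κ * q * d1 * d2 - (1 - κ * q) * ((x + d1) * (y + d1))) /
        ((x + d1) * (y + d1)) := by
    unfold Phi
    field_simp
    ring
  have : 0 < Phi κ q d1 d2 y 0 - Phi κ q d1 d2 x 0 := by
    rw [key]
    exact div_pos (mul_pos (by linarith) hpos) (mul_pos hx0 hy0)
  exact sub_pos.1 this
end
end

section
/- Let κ ∈ (0,1), q ∈ [0,1], and let d₁, d₂ > 0 be real numbers with q > d₁/(κ(d₁+d₂)). Define Φ : ℝ²₊ → ℝ by Φ(b₁,b₂) = b₁·(κ(b₁+d₁+b₂+d₂)q/(b₁+d₁) − 1) + b₂·(κ(b₁+d₁+b₂+d₂)(1−q)/(b₂+d₂) − 1), and set b₁* = √(κqd₁d₂/(1−κq)) − d₁. Then for every b₁ with 0 ≤ b₁ < b₁*, the function b₂ ↦ Φ(b₁, b₂) is strictly decreasing on [0, ∞). -/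
open Set

noncomputable section

/-- For any `b₁` below Isaacs' optimal wager `b₁*`, the atomic bettor's expected
profit is strictly decreasing in her wager `b₂` on Outcome 2. -/
theorem stmt_16 (κ q d1 d2 : ℝ) (hκ : κ ∈ Ioo (0:ℝ) 1) (hq : q ∈ Icc (0:ℝ) 1)
    (hd1 : 0 < d1) (hd2 : 0 < d2) (h : q > d1 / (κ * (d1 + d2))) :
    ∀ b1 : ℝ, 0 ≤ b1 → b1 < Real.sqrt (κ * q * d1 * d2 / (1 - κ * q)) - d1 →
      StrictAntiOn (fun b2 => Phi κ q d1 d2 b1 b2) (Ici 0) := by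
  intro b1 hb1 hlt u hu v hv huv
  obtain ⟨hκ0, hκ1⟩ := hκ
  obtain ⟨hq0, hq1⟩ := hq
  have hu0 : 0 ≤ u := hu
  have hv0 : 0 ≤ v := hv
  have hkq : 0 < 1 - κ * q := by nlinarith
  have hx : 0 < b1 + d1 := by linarith
  have hy : 0 < u + d2 := by linarith
  have hz : 0 < v + d2 := by linarith
  have hsq : (b1 + d1) ^ 2 < κ * q * d1 * d2 / (1 - κ * q) :=
    (Real.lt_sqrt hx.le).1 (by linarith)
  rw [lt_div_iff₀ hkq] at hsq
  have key : (b1 + d1) * (1 - κ * q) / d2 < κ * q * d1 / (b1 + d1) := by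
    rw [div_lt_div_iff₀ hd2 hx]
    nlinarith
  have hyz : d2 * d2 ≤ (u + d2) * (v + d2) := by nlinarith [mul_nonneg hu0 hv0]
  have key2 : κ * (1 - q) * d2 * (b1 + d1) / ((u + d2) * (v + d2))
      ≤ κ * (1 - q) * (b1 + d1) / d2 := by
    rw [div_le_div_iff₀ (by positivity) hd2]
    have hc : 0 ≤ κ * (1 - q) * (b1 + d1) :=
      mul_nonneg (mul_nonneg hκ0.le (by linarith)) hx.le
    nlinarith [mul_le_mul_of_nonneg_left hyz hc]
  have hdiff : Phi κ q d1 d2 b1 v - Phi κ q d1 d2 b1 u =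
      (v - u) * (κ - 1 - κ * q * d1 / (b1 + d1)
        + κ * (1 - q) * d2 * (b1 + d1) / ((u + d2) * (v + d2))) := by
    unfold Phi
    field_simp
    ring
  have h3 : (b1 + d1) * (1 - κ * q) / d2 - κ * (1 - q) * (b1 + d1) / d2
      = (1 - κ) * ((b1 + d1) / d2) := by ring
  have h4 : 0 < (1 - κ) * ((b1 + d1) / d2) :=
    mul_pos (by linarith) (div_pos hx hd2)
  have hneg : κ - 1 - κ * q * d1 / (b1 + d1)
        + κ * (1 - q) * d2 * (b1 + d1) / ((u + d2) * (v + d2)) < 0 := by linarith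
  have := mul_neg_of_pos_of_neg (sub_pos.2 huv) hneg
  show Phi κ q d1 d2 b1 v < Phi κ q d1 d2 b1 u
  linarith
end
end

section
/- Let κ ∈ (0,1), q ∈ [0,1], and let d₁, d₂ > 0 be real numbers with q > d₁/(κ(d₁+d₂)). Define Φ : ℝ²₊ → ℝ by Φ(b₁,b₂) = b₁·(κ(b₁+d₁+b₂+d₂)q/(b₁+d₁) − 1) + b₂·(κ(b₁+d₁+b₂+d₂)(1−q)/(b₂+d₂) − 1), and set b₁* = √(κqd₁d₂/(1−κq)) − d₁. Then Φ attains a unique global maximum on ℝ²₊ at the point (b₁*, 0); that is, Φ(b₁,b₂) < Φ(b₁*, 0) for every (b₁,b₂) ∈ ℝ²₊ with (b₁,b₂) ≠ (b₁*, 0). -/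
open Set

noncomputable section

/-- The loss in the coordinates `x = b1 + d1`, `y = b2 + d2`. -/
def lossF (κ q d1 d2 x y : ℝ) : ℝ :=
  (1 - κ) * (x + y) + κ * q * d1 * (y / x) + κ * (1 - q) * d2 * (x / y)

lemma Phi_eq (κ q d1 d2 x y : ℝ) (hx : 0 < x) (hy : 0 < y) :
    Phi κ q d1 d2 (x - d1) (y - d2) =
      d1 + d2 - κ * q * d1 - κ * (1 - q) * d2 - lossF κ q d1 d2 x y := by
  unfold Phi lossF
  have e1 : x - d1 + d1 = x := by ring
  have e2 : x - d1 + d1 + (y - d2) + d2 = x + y := by ring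
  have e3 : y - d2 + d2 = y := by ring
  rw [e2, e1, e3]
  field_simp
  ring

lemma lossF_scale (κ q d1 d2 x y t : ℝ) (ht : 0 < t) :
    lossF κ q d1 d2 (t * x) (t * y) =
      lossF κ q d1 d2 x y + (t - 1) * ((1 - κ) * (x + y)) := by
  unfold lossF
  rw [mul_div_mul_left _ _ ht.ne', mul_div_mul_left _ _ ht.ne']
  ring

lemma lossF_row (κ q d1 d2 x s : ℝ) (hd2 : 0 < d2) (hx : 0 < x) (hs : 0 < s)
    (hss : (1 - κ * q) * s ^ 2 = κ * q * d1 * d2) :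
    lossF κ q d1 d2 x d2 = lossF κ q d1 d2 s d2 + (1 - κ * q) * (x - s) ^ 2 / x := by
  unfold lossF
  have e : κ * q * d1 * (d2 / x) = (1 - κ * q) * s ^ 2 / x := by rw [hss]; ring
  have e' : κ * q * d1 * (d2 / s) = (1 - κ * q) * s ^ 2 / s := by rw [hss]; ring
  rw [e, e']
  field_simp
  ring

lemma lossF_col (κ q d1 d2 y : ℝ) (hd1 : 0 < d1) (hd2 : 0 < d2) (hy : 0 < y) :
    lossF κ q d1 d2 d1 y = lossF κ q d1 d2 d1 d2 +
      (y - d2) * ((1 - κ * (1 - q)) * y - κ * (1 - q) * d1) / y := by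
  unfold lossF
  field_simp
  ring

/-- Isaacs' theorem: `Φ` attains a unique global maximum on `ℝ²₊` at `(b₁*, 0)`. -/
theorem stmt_17 (κ q d1 d2 : ℝ) (hκ : κ ∈ Ioo (0:ℝ) 1) (hq : q ∈ Icc (0:ℝ) 1)
    (hd1 : 0 < d1) (hd2 : 0 < d2) (h : q > d1 / (κ * (d1 + d2))) :
    ∀ b1 b2 : ℝ, 0 ≤ b1 → 0 ≤ b2 →
      (b1, b2) ≠ (Real.sqrt (κ * q * d1 * d2 / (1 - κ * q)) - d1, 0) →
      Phi κ q d1 d2 b1 b2 <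
        Phi κ q d1 d2 (Real.sqrt (κ * q * d1 * d2 / (1 - κ * q)) - d1) 0 := by
  obtain ⟨hκ0, hκ1⟩ := hκ
  obtain ⟨hq0, hq1⟩ := hq
  have hp : d1 < κ * q * (d1 + d2) := by
    rw [gt_iff_lt, div_lt_iff₀ (by positivity)] at h
    linarith
  have hkq : 0 < 1 - κ * q := by nlinarith
  set s := Real.sqrt (κ * q * d1 * d2 / (1 - κ * q)) with hsdef
  have hss : (1 - κ * q) * s ^ 2 = κ * q * d1 * d2 := by
    rw [hsdef, Real.sq_sqrt (by positivity)]
    field_simp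
  have hs1 : d1 < s := by
    rw [hsdef]
    apply Real.lt_sqrt_of_sq_lt
    rw [lt_div_iff₀ hkq]
    nlinarith
  have hs : 0 < s := hd1.trans hs1
  intro b1 b2 hb1 hb2 hne
  have key : ∀ x y : ℝ, d1 ≤ x → d2 ≤ y → (x ≠ s ∨ y ≠ d2) →
      lossF κ q d1 d2 s d2 < lossF κ q d1 d2 x y := by
    intro x y hx hy hxy
    have hx0 : 0 < x := hd1.trans_le hx
    have hy0 : 0 < y := hd2.trans_le hy
    rcases le_or_gt (y * d1) (x * d2) with hc | hc
    · rcases hy.eq_or_lt with rfl | hlt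
      · have hxs : x - s ≠ 0 := sub_ne_zero.mpr (by simpa using hxy)
        rw [lossF_row κ q d1 d2 x s hd2 hx0 hs hss]
        have : 0 < (1 - κ * q) * (x - s) ^ 2 / x := by positivity
        linarith
      · have h1 := lossF_scale κ q d1 d2 (x * d2 / y) d2 (y / d2) (by positivity)
        have e1 : y / d2 * (x * d2 / y) = x := by field_simp
        have e2 : y / d2 * d2 = y := by field_simp
        rw [e1, e2, lossF_row κ q d1 d2 (x * d2 / y) s hd2 (by positivity) hs hss] at h1
        have h2 : 0 ≤ (1 - κ * q) * (x * d2 / y - s) ^ 2 / (x * d2 / y) := by positivity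
        have h3 : 0 < y / d2 - 1 := by
          have := (one_lt_div hd2).mpr hlt
          linarith
        have h5 : 0 < 1 - κ := by linarith
        have h4 : 0 < (y / d2 - 1) * ((1 - κ) * (x * d2 / y + d2)) := by positivity
        linarith
    · have h1 := lossF_scale κ q d1 d2 d1 (y * d1 / x) (x / d1) (by positivity)
      have e1 : x / d1 * d1 = x := by field_simp
      have e2 : x / d1 * (y * d1 / x) = y := by field_simp
      have hz : d2 < y * d1 / x := by
        rw [lt_div_iff₀ hx0]; linarith
      set z := y * d1 / x with hzdef
      have hz0 : 0 < z := hd2.trans hz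
      rw [e1, e2, lossF_col κ q d1 d2 z hd1 hd2 hz0,
        lossF_row κ q d1 d2 d1 s hd2 hd1 hs hss] at h1
      have h2 : 0 ≤ (1 - κ * q) * (d1 - s) ^ 2 / d1 := by positivity
      have h3 : 0 ≤ x / d1 - 1 := by
        have := (one_le_div hd1).mpr hx
        linarith
      have h5 : 0 < 1 - κ := by linarith
      have h4 : 0 ≤ (x / d1 - 1) * ((1 - κ) * (d1 + z)) := by positivity
      have h6 : 0 < (1 - κ * (1 - q)) * z - κ * (1 - q) * d1 := by
        have h7 : 0 < 1 - κ * (1 - q) := by nlinarith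
        have h8 : (1 - κ * (1 - q)) * d2 < (1 - κ * (1 - q)) * z :=
          mul_lt_mul_of_pos_left hz h7
        nlinarith
      have h9 : 0 < z - d2 := by linarith
      have h10 : 0 < (z - d2) * ((1 - κ * (1 - q)) * z - κ * (1 - q) * d1) / z := by
        positivity
      linarith
  have hk := key (b1 + d1) (b2 + d2) (by linarith) (by linarith) (by
    by_contra hcon
    push Not at hcon
    apply hne
    rw [Prod.mk.injEq]
    constructor <;> linarith [hcon.1, hcon.2])
  have p1 := Phi_eq κ q d1 d2 (b1 + d1) (b2 + d2) (by linarith) (by linarith)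
  have p2 := Phi_eq κ q d1 d2 s d2 hs hd2
  rw [add_sub_cancel_right, add_sub_cancel_right] at p1
  rw [sub_self] at p2
  rw [p1, p2]
  linarith
end
end

section
/- Fix κ ∈ (1/2,1) and a finite Borel measure μ on [0,1] having a continuous, everywhere positive density with respect to Lebesgue measure, and for p ∈ [1−κ, κ] set M₁(p) = μ((p/κ, 1]) and M₂(p) = μ([0, 1 − (1−p)/κ)). Then the map p ↦ M₁(p)/(κ(M₁(p)+M₂(p))) is continuous and strictly decreasing on [1−κ, κ], takes the value 1/κ at p = 1−κ and the value 0 at p = κ, and consequently for every q ∈ [0,1] there exists a unique p̄₁ ∈ (1−κ, κ] such that q = M₁(p̄₁)/(κ(M₁(p̄₁)+M₂(p̄₁))); moreover p̄₁ = κ if and only if q = 0. -/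
open MeasureTheory Set

noncomputable section

theorem nice_aux (μ : Measure ℝ) (hμ : NiceDensity μ) :
    ∃ F : ℝ → ℝ, Continuous F ∧ StrictMono F ∧
      (∀ x ∈ Icc (0:ℝ) 1, (μ (Ioc x 1)).toReal = F 1 - F x) ∧
      (∀ x ∈ Icc (0:ℝ) 1, (μ (Ico 0 x)).toReal = F x - F 0) := by
  obtain ⟨g, hgc, hgp, rfl⟩ := hμ
  set G : ℝ → ℝ := IccExtend (zero_le_one (α := ℝ)) ((Icc (0:ℝ) 1).restrict g) with hG
  have hGc : Continuous G := (continuousOn_iff_continuous_restrict.1 hgc).Icc_extend'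
  have hGp : ∀ x, 0 < G x := fun x => hgp _ (projIcc (0:ℝ) 1 zero_le_one x).2
  have hGg : ∀ x ∈ Icc (0:ℝ) 1, G x = g x := fun x hx => by
    rw [hG, IccExtend_of_mem _ _ hx]; rfl
  have hint : ∀ a b : ℝ, IntervalIntegrable G volume a b := fun a b => hGc.intervalIntegrable a b
  have key : ∀ s : Set ℝ, MeasurableSet s → s ⊆ Icc 0 1 →
      (((volume.restrict (Icc (0:ℝ) 1)).withDensity (fun p => ENNReal.ofReal (g p))) s).toReal
        = ∫ x in s, G x := by
    intro s hs hsub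
    rw [withDensity_apply _ hs, Measure.restrict_restrict hs, inter_eq_left.2 hsub,
      integral_eq_lintegral_of_nonneg_ae (Filter.Eventually.of_forall fun x => (hGp x).le)
        hGc.aestronglyMeasurable]
    congr 1
    refine setLIntegral_congr_fun hs fun x hx => ?_
    simp only [hGg x (hsub hx)]
  have hsub : ∀ a b : ℝ, (∫ t in (0:ℝ)..b, G t) - (∫ t in (0:ℝ)..a, G t) = ∫ t in a..b, G t :=
    fun a b => intervalIntegral.integral_interval_sub_left (hint _ _) (hint _ _)
  refine ⟨fun x => ∫ t in (0:ℝ)..x, G t,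
    intervalIntegral.continuous_primitive hint 0, ?_, ?_, ?_⟩
  · intro a b hab
    have := intervalIntegral.intervalIntegral_pos_of_pos (hint a b) hGp hab
    have := hsub a b
    simp only
    linarith
  · intro x hx
    simp only
    rw [hsub, key _ measurableSet_Ioc (fun y hy => ⟨hx.1.trans hy.1.le, hy.2⟩),
      intervalIntegral.integral_of_le hx.2]
  · intro x hx
    simp only
    rw [hsub, key _ measurableSet_Ico (fun y hy => ⟨hy.1, hy.2.le.trans hx.2⟩),
      intervalIntegral.integral_of_le hx.1, integral_Ico_eq_integral_Ioo,
      integral_Ioc_eq_integral_Ioo]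

/-- Step 3 of the main theorem: the map `p ↦ M₁(p)/(κ(M₁(p)+M₂(p)))` is continuous
and strictly decreasing on `[1-κ, κ]`, takes value `1/κ` at `1-κ` and `0` at `κ`,
so for each `q ∈ [0,1]` there is a unique `p̄₁ ∈ (1-κ, κ]` where it equals `q`;
moreover `p̄₁ = κ` iff `q = 0`. -/
theorem stmt_18 (κ : ℝ) (hκ : κ ∈ Ioo (1/2 : ℝ) 1)
    (μ : Measure ℝ) (hμ : NiceDensity μ) :
    ContinuousOn (fun p => M1 μ κ p / (κ * (M1 μ κ p + M2 μ κ p))) (Icc (1 - κ) κ) ∧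
    StrictAntiOn (fun p => M1 μ κ p / (κ * (M1 μ κ p + M2 μ κ p))) (Icc (1 - κ) κ) ∧
    M1 μ κ (1 - κ) / (κ * (M1 μ κ (1 - κ) + M2 μ κ (1 - κ))) = 1 / κ ∧
    M1 μ κ κ / (κ * (M1 μ κ κ + M2 μ κ κ)) = 0 ∧
    ∀ q ∈ Icc (0:ℝ) 1,
      (∃! p, p ∈ Ioc (1 - κ) κ ∧ q = M1 μ κ p / (κ * (M1 μ κ p + M2 μ κ p))) ∧
      ∀ p ∈ Ioc (1 - κ) κ, q = M1 μ κ p / (κ * (M1 μ κ p + M2 μ κ p)) →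
        (p = κ ↔ q = 0) := by
  obtain ⟨h1, h2⟩ := hκ
  have hκ0 : 0 < κ := by linarith
  obtain ⟨F, hFc, hFm, hF1, hF2⟩ := nice_aux μ hμ
  have e1 : ∀ p ∈ Icc (1 - κ) κ, M1 μ κ p = F 1 - F (p / κ) := fun p hp =>
    hF1 _ ⟨div_nonneg (by linarith [hp.1]) hκ0.le, (div_le_one hκ0).2 hp.2⟩
  have e2 : ∀ p ∈ Icc (1 - κ) κ, M2 μ κ p = F (1 - (1 - p) / κ) - F 0 := fun p hp => by
    have a1 : (1 - p) / κ ≤ 1 := (div_le_one hκ0).2 (by linarith [hp.1])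
    have a2 : 0 ≤ (1 - p) / κ := div_nonneg (by linarith [hp.2]) hκ0.le
    exact hF2 _ ⟨by linarith, by linarith⟩
  have ml : 1 - κ ∈ Icc (1 - κ) κ := ⟨le_rfl, by linarith⟩
  have mr : κ ∈ Icc (1 - κ) κ := ⟨by linarith, le_rfl⟩
  have A : StrictAntiOn (M1 μ κ) (Icc (1 - κ) κ) := by
    intro p hp p' hp' h
    rw [e1 p hp, e1 p' hp']
    have := hFm (div_lt_div_of_pos_right h hκ0)
    linarith
  have B : StrictMonoOn (M2 μ κ) (Icc (1 - κ) κ) := by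
    intro p hp p' hp' h
    rw [e2 p hp, e2 p' hp']
    have h3 : (1 - p') / κ < (1 - p) / κ := div_lt_div_of_pos_right (by linarith) hκ0
    have := hFm (show 1 - (1 - p) / κ < 1 - (1 - p') / κ by linarith)
    linarith
  have Aκ : M1 μ κ κ = 0 := by rw [e1 κ mr, div_self hκ0.ne', sub_self]
  have Bl : M2 μ κ (1 - κ) = 0 := by
    rw [e2 _ ml, sub_sub_cancel, div_self hκ0.ne', sub_self, sub_self]
  have A0 : ∀ p, 0 ≤ M1 μ κ p := fun p => ENNReal.toReal_nonneg
  have B0 : ∀ p, 0 ≤ M2 μ κ p := fun p => ENNReal.toReal_nonneg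
  have S : ∀ p ∈ Icc (1 - κ) κ, 0 < M1 μ κ p + M2 μ κ p := by
    intro p hp
    rcases hp.2.lt_or_eq with h | h
    · have := A hp mr h
      linarith [B0 p]
    · have := B ml mr (by linarith)
      rw [h]
      linarith
  have Ac : ContinuousOn (M1 μ κ) (Icc (1 - κ) κ) :=
    ContinuousOn.congr (f := fun p => F 1 - F (p / κ)) (by fun_prop) e1
  have Bc : ContinuousOn (M2 μ κ) (Icc (1 - κ) κ) :=
    ContinuousOn.congr (f := fun p => F (1 - (1 - p) / κ) - F 0) (by fun_prop) e2
  have C : ContinuousOn (fun p => M1 μ κ p / (κ * (M1 μ κ p + M2 μ κ p))) (Icc (1 - κ) κ) :=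
    Ac.div (continuousOn_const.mul (Ac.add Bc)) fun p hp => (mul_pos hκ0 (S p hp)).ne'
  have D : StrictAntiOn (fun p => M1 μ κ p / (κ * (M1 μ κ p + M2 μ κ p))) (Icc (1 - κ) κ) := by
    intro p hp p' hp' h
    have a := A hp hp' h
    have b := B hp hp' h
    simp only
    rw [div_lt_div_iff₀ (mul_pos hκ0 (S p' hp')) (mul_pos hκ0 (S p hp))]
    have c1 := mul_le_mul_of_nonneg_right a.le (B0 p)
    have c2 := mul_lt_mul_of_pos_left b (lt_of_le_of_lt (A0 p') a)
    have c3 := mul_lt_mul_of_pos_left (c1.trans_lt c2) hκ0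
    linarith
  have V1 : M1 μ κ (1 - κ) / (κ * (M1 μ κ (1 - κ) + M2 μ κ (1 - κ))) = 1 / κ := by
    have := S _ ml
    rw [Bl, add_zero] at this ⊢
    field_simp
  have V2 : M1 μ κ κ / (κ * (M1 μ κ κ + M2 μ κ κ)) = 0 := by rw [Aκ, zero_div]
  refine ⟨C, D, V1, V2, fun q hq => ⟨?_, ?_⟩⟩
  · have h3 : 1 < 1 / κ := (one_lt_div hκ0).2 h2
    obtain ⟨p, hp, hpq⟩ := intermediate_value_Icc' (by linarith) C
      (show q ∈ Icc _ _ from ⟨V2.le.trans hq.1, (hq.2.trans h3.le).trans V1.ge⟩)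
    simp only at hpq
    refine ⟨p, ⟨⟨lt_of_le_of_ne hp.1 ?_, hp.2⟩, hpq.symm⟩, ?_⟩
    · rintro rfl
      rw [V1] at hpq
      linarith [hq.2]
    · rintro p' ⟨hp', h'⟩
      exact D.injOn (Ioc_subset_Icc_self hp') hp (h'.symm.trans hpq.symm)
  · intro p hp h
    constructor
    · rintro rfl
      rw [h, V2]
    · intro h0
      exact D.injOn (Ioc_subset_Icc_self hp) mr ((h.symm.trans h0).trans V2.symm)
end
end

section
/- Fix κ ∈ (1/2,1) and a finite Borel measure μ on [0,1] having a continuous, everywhere positive density with respect to Lebesgue measure, and for p ∈ [1−κ, κ] set M₁(p) = μ((p/κ, 1]) and M₂(p) = μ([0, 1 − (1−p)/κ)). Then the map p ↦ M₂(p)/(κ(M₁(p)+M₂(p))) is continuous and strictly increasing on [1−κ, κ], takes the value 0 at p = 1−κ and the value 1/κ at p = κ, and consequently for every q ∈ [0,1] there exists a unique p̄₂ ∈ [1−κ, κ) such that 1−q = M₂(p̄₂)/(κ(M₁(p̄₂)+M₂(p̄₂))), with p̄₂ = 1−κ if and only if q = 1; moreover, if p̄₁ ∈ (1−κ, κ]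 is the unique point with q = M₁(p̄₁)/(κ(M₁(p̄₁)+M₂(p̄₁))), then p̄₂ < p̄₁. -/
open MeasureTheory Set

noncomputable section

theorem exists_primitive (μ : Measure ℝ) (hμ : NiceDensity μ) :
    ∃ F : ℝ → ℝ, Continuous F ∧ StrictMono F ∧ ∀ a b : ℝ, 0 ≤ a → a ≤ b → b ≤ 1 →
      (μ (Ioc a b)).toReal = F b - F a ∧ (μ (Ico a b)).toReal = F b - F a := by
  obtain ⟨g, hg, hpos, rfl⟩ := hμ
  obtain ⟨G, hG, hGpos, hGg⟩ : ∃ G : ℝ → ℝ, Continuous G ∧ (∀ x, 0 < G x) ∧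
      ∀ x ∈ Icc (0:ℝ) 1, G x = g x := by
    refine ⟨IccExtend (zero_le_one' ℝ) (fun x => g x.1), ?_, ?_, ?_⟩
    · exact (continuousOn_iff_continuous_domRestrict.1 hg).Icc_extend'
    · intro x
      exact hpos _ (projIcc 0 1 _ x).2
    · intro x hx
      rw [IccExtend_of_mem _ _ hx]
  have hint : ∀ a b, IntervalIntegrable G volume a b := fun a b => hG.intervalIntegrable a b
  have key : ∀ a b : ℝ, 0 ≤ a → a ≤ b → b ≤ 1 → ∀ S : Set ℝ, MeasurableSet S → S ⊆ Icc a b →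
      S =ᵐ[volume] Ioc a b →
      (((volume.restrict (Icc (0:ℝ) 1)).withDensity (fun p => ENNReal.ofReal (g p))) S).toReal
        = ∫ t in a..b, G t := by
    intro a b ha hab hb S hS hSs hae
    have hS1 : S ⊆ Icc 0 1 := hSs.trans (Icc_subset_Icc ha hb)
    rw [withDensity_apply _ hS, Measure.restrict_restrict hS, inter_eq_left.2 hS1,
      intervalIntegral.integral_of_le hab, ← setIntegral_congr_set hae,
      integral_eq_lintegral_of_nonneg_ae (Filter.Eventually.of_forall fun x => (hGpos x).le)
        hG.aestronglyMeasurable]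
    congr 1
    refine setLIntegral_congr_fun hS ?_
    intro x hx
    simp only [hGg x (hS1 hx)]
  refine ⟨fun x => ∫ t in (0:ℝ)..x, G t, intervalIntegral.continuous_primitive hint 0, ?_, ?_⟩
  · intro a b hab
    have h := intervalIntegral.intervalIntegral_pos_of_pos (hint a b) hGpos hab
    have h2 := intervalIntegral.integral_interval_sub_left (hint 0 b) (hint 0 a)
    simp only
    linarith
  · intro a b ha hab hb
    have h2 := intervalIntegral.integral_interval_sub_left (hint 0 b) (hint 0 a)
    simp only
    rw [h2]
    exact ⟨key a b ha hab hb _ measurableSet_Ioc Ioc_subset_Icc_self (ae_eq_refl _),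
      key a b ha hab hb _ measurableSet_Ico Ico_subset_Icc_self Ico_ae_eq_Ioc⟩

/-- Step 3 of the main theorem (second half): the map `p ↦ M₂(p)/(κ(M₁(p)+M₂(p)))`
is continuous and strictly increasing on `[1-κ, κ]`, takes value `0` at `1-κ` and
`1/κ` at `κ`, so for each `q ∈ [0,1]` there is a unique `p̄₂ ∈ [1-κ, κ)` where it
equals `1-q`, with `p̄₂ = 1-κ` iff `q = 1`; moreover `p̄₂ < p̄₁`. -/
theorem stmt_19 (κ : ℝ) (hκ : κ ∈ Ioo (1/2 : ℝ) 1)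
    (μ : Measure ℝ) (hμ : NiceDensity μ) :
    ContinuousOn (fun p => M2 μ κ p / (κ * (M1 μ κ p + M2 μ κ p))) (Icc (1 - κ) κ) ∧
    StrictMonoOn (fun p => M2 μ κ p / (κ * (M1 μ κ p + M2 μ κ p))) (Icc (1 - κ) κ) ∧
    M2 μ κ (1 - κ) / (κ * (M1 μ κ (1 - κ) + M2 μ κ (1 - κ))) = 0 ∧
    M2 μ κ κ / (κ * (M1 μ κ κ + M2 μ κ κ)) = 1 / κ ∧
    ∀ q ∈ Icc (0:ℝ) 1,
      (∃! p, p ∈ Ico (1 - κ) κ ∧ 1 - q = M2 μ κ p / (κ * (M1 μ κ p + M2 μ κ p))) ∧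
      (∀ p ∈ Ico (1 - κ) κ, 1 - q = M2 μ κ p / (κ * (M1 μ κ p + M2 μ κ p)) →
        (p = 1 - κ ↔ q = 1)) ∧
      ∀ p1 ∈ Ioc (1 - κ) κ, ∀ p2 ∈ Ico (1 - κ) κ,
        q = M1 μ κ p1 / (κ * (M1 μ κ p1 + M2 μ κ p1)) →
        1 - q = M2 μ κ p2 / (κ * (M1 μ κ p2 + M2 μ κ p2)) →
        p2 < p1 := by
  obtain ⟨F, hFc, hFm, hF⟩ := exists_primitive μ hμ
  obtain ⟨hκ1, hκ2⟩ := hκ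
  have hκ0 : 0 < κ := by linarith
  have hm1 : ∀ p ∈ Icc (1 - κ) κ, M1 μ κ p = F 1 - F (p / κ) := by
    intro p hp
    refine (hF _ _ (div_nonneg (by linarith [hp.1]) hκ0.le) ?_ le_rfl).1
    rw [div_le_one hκ0]; exact hp.2
  have hm2 : ∀ p ∈ Icc (1 - κ) κ, M2 μ κ p = F (1 - (1 - p) / κ) - F 0 := by
    intro p hp
    refine (hF _ _ le_rfl ?_ ?_).2
    · have : (1 - p) / κ ≤ 1 := by rw [div_le_one hκ0]; linarith [hp.1]
      linarith
    · have : 0 ≤ (1 - p) / κ := div_nonneg (by linarith [hp.2]) hκ0.le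
      linarith
  have hanti : ∀ p ∈ Icc (1 - κ) κ, ∀ r ∈ Icc (1 - κ) κ, p < r → M1 μ κ r < M1 μ κ p := by
    intro p hp r hr h
    rw [hm1 p hp, hm1 r hr]
    have := hFm (div_lt_div_of_pos_right h hκ0)
    linarith
  have hmono : ∀ p ∈ Icc (1 - κ) κ, ∀ r ∈ Icc (1 - κ) κ, p < r → M2 μ κ p < M2 μ κ r := by
    intro p hp r hr h
    rw [hm2 p hp, hm2 r hr]
    have h1 : (1 - r) / κ < (1 - p) / κ := div_lt_div_of_pos_right (by linarith) hκ0
    have := hFm (show 1 - (1 - p) / κ < 1 - (1 - r) / κ by linarith)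
    linarith
  have hl : 1 - κ ∈ Icc (1 - κ) κ := ⟨le_rfl, by linarith⟩
  have hr : κ ∈ Icc (1 - κ) κ := ⟨by linarith, le_rfl⟩
  have h1κ : M1 μ κ κ = 0 := by rw [hm1 κ hr, div_self hκ0.ne', sub_self]
  have h2κ : M2 μ κ (1 - κ) = 0 := by
    rw [hm2 _ hl, sub_sub_cancel, div_self hκ0.ne', sub_self, sub_self]
  have n1 : ∀ p, 0 ≤ M1 μ κ p := fun p => ENNReal.toReal_nonneg
  have n2 : ∀ p, 0 ≤ M2 μ κ p := fun p => ENNReal.toReal_nonneg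
  have h2pos : 0 < M2 μ κ κ := by
    rw [← h2κ]; exact hmono _ hl _ hr (by linarith)
  have hS : ∀ p ∈ Icc (1 - κ) κ, 0 < M1 μ κ p + M2 μ κ p := by
    intro p hp
    rcases hp.2.lt_or_eq with h | h
    · have := hanti p hp κ hr h
      linarith [n2 p]
    · rw [h]; linarith
  have c1 : ContinuousOn (M1 μ κ) (Icc (1 - κ) κ) :=
    ContinuousOn.congr (f := fun p => F 1 - F (p / κ)) (by fun_prop) hm1
  have c2 : ContinuousOn (M2 μ κ) (Icc (1 - κ) κ) :=
    ContinuousOn.congr (f := fun p => F (1 - (1 - p) / κ) - F 0) (by fun_prop) hm2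
  have hcont : ContinuousOn (fun p => M2 μ κ p / (κ * (M1 μ κ p + M2 μ κ p)))
      (Icc (1 - κ) κ) :=
    c2.div (continuousOn_const.mul (c1.add c2)) fun p hp => (mul_pos hκ0 (hS p hp)).ne'
  have hsm : StrictMonoOn (fun p => M2 μ κ p / (κ * (M1 μ κ p + M2 μ κ p)))
      (Icc (1 - κ) κ) := by
    intro p hp r hr h
    have a := hanti p hp r hr h
    have b := hmono p hp r hr h
    simp only
    rw [div_lt_div_iff₀ (mul_pos hκ0 (hS p hp)) (mul_pos hκ0 (hS r hr))]
    have e : M2 μ κ p * M1 μ κ r < M2 μ κ r * M1 μ κ p := by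
      have e1 : M2 μ κ p * M1 μ κ r ≤ M2 μ κ p * M1 μ κ p :=
        mul_le_mul_of_nonneg_left a.le (n2 p)
      have e2 : M2 μ κ p * M1 μ κ p < M2 μ κ r * M1 μ κ p :=
        mul_lt_mul_of_pos_right b ((n1 r).trans_lt a)
      linarith
    nlinarith [mul_lt_mul_of_pos_left e hκ0]
  have hv0 : M2 μ κ (1 - κ) / (κ * (M1 μ κ (1 - κ) + M2 μ κ (1 - κ))) = 0 := by
    rw [h2κ, zero_div]
  have hv1 : M2 μ κ κ / (κ * (M1 μ κ κ + M2 μ κ κ)) = 1 / κ := by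
    rw [h1κ, zero_add]; field_simp
  have hk1 : 1 < 1 / κ := by rw [lt_div_iff₀ hκ0]; linarith
  refine ⟨hcont, hsm, hv0, hv1, ?_⟩
  intro q hq
  have hsub : Ico (1 - κ) κ ⊆ Icc (1 - κ) κ := Ico_subset_Icc_self
  refine ⟨?_, ?_, ?_⟩
  · have hivt := intermediate_value_Ico (show 1 - κ ≤ κ by linarith) hcont
    simp only [hv0, hv1] at hivt
    obtain ⟨p, hp, hpq⟩ := hivt (show 1 - q ∈ Ico 0 (1 / κ) from
      ⟨by linarith [hq.2], by linarith [hq.1]⟩)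
    refine ⟨p, ⟨hp, hpq.symm⟩, ?_⟩
    rintro r ⟨hr, hrq⟩
    exact hsm.injOn (hsub hr) (hsub hp) (hrq.symm.trans hpq.symm)
  · intro p hp hpq
    constructor
    · rintro rfl
      rw [hv0] at hpq; linarith
    · rintro rfl
      refine hsm.injOn (hsub hp) hl ?_
      rw [hv0, ← hpq, sub_self]
  · intro p1 hp1 p2 hp2 e1 e2
    have hp1' : p1 ∈ Icc (1 - κ) κ := Ioc_subset_Icc_self hp1
    refine (hsm.lt_iff_lt (hsub hp2) hp1').1 ?_
    rw [← e2]
    have hs := (hS p1 hp1').ne'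
    have : M1 μ κ p1 / (κ * (M1 μ κ p1 + M2 μ κ p1)) +
        M2 μ κ p1 / (κ * (M1 μ κ p1 + M2 μ κ p1)) = 1 / κ := by
      field_simp
    linarith
end
end
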